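/- arXiv:alg-geom/9609002 — 2 statements merged into one kernel-verified Lean document; each statement's English description precedes it below -/
import Mathlib

section
/- Let T(w) be a symmetric N×N matrix whose entries are polynomial functions of w ∈ W ⊆ ℝ^m, and suppose det T(w) ≠ 0 for w in a subset U ⊆ W. Then the signature of T(w), as a function of w ∈ U, can be written as a finite sum of signs of polynomial functions of w: there exist polynomials q_1, ..., q_t on W, nowhere vanishing on a Zariski-open dense subset U' ⊆ U, with signature T(w) = sgn q_1(w) + ... + sgn q_t(w) for w ∈ U'. -/
/-- Sign of a real number as an integer. -/
noncomputable def sgn (t : ℝ) : ℤ := if 0 < t then 1 else if t < 0 then -1 else 0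

/-- The signature (number of positive minus number of negative eigenvalues, with
multiplicity) of a real symmetric (Hermitian) matrix. -/
noncomputable def msig {N : ℕ} (A : Matrix (Fin N) (Fin N) ℝ) (hA : A.IsHermitian) : ℤ :=
  ((Finset.univ.filter fun i => 0 < hA.eigenvalues i).card : ℤ) -
    ((Finset.univ.filter fun i => hA.eigenvalues i < 0).card : ℤ)

open Matrix in
lemma equiv_of_congr {N : ℕ} (A P : Matrix (Fin N) (Fin N) ℝ) (d : Fin N → ℝ)
    (hP : P.det ≠ 0) (h : Pᵀ * A * P = Matrix.diagonal d) :
    QuadraticMap.Equivalent A.toQuadraticForm' (QuadraticMap.weightedSumSquares ℝ d) := by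
  have hU : IsUnit P.det := isUnit_iff_ne_zero.mpr hP
  let _ : Invertible P := P.invertibleOfIsUnitDet hU
  refine QuadraticMap.Equivalent.symm ⟨⟨P.toLinearEquiv' inferInstance, ?_⟩⟩
  intro x
  have h1 : x ⬝ᵥ ((Pᵀ * A * P) *ᵥ x) = x ⬝ᵥ (Matrix.diagonal d *ᵥ x) := by rw [h]
  have h2 : A.toQuadraticForm' (P *ᵥ x) = x ⬝ᵥ ((Pᵀ * A * P) *ᵥ x) := by
    simp only [Matrix.toQuadraticForm', LinearMap.BilinMap.toQuadraticMap_apply,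
      Matrix.toLinearMap₂'_apply']
    rw [← Matrix.mulVec_mulVec, ← Matrix.mulVec_mulVec, Matrix.dotProduct_mulVec x Pᵀ,
      Matrix.vecMul_transpose]
  change A.toQuadraticForm' (P *ᵥ x) = _
  rw [h2, h1, QuadraticMap.weightedSumSquares_apply]
  simp only [dotProduct, Matrix.mulVec_diagonal, smul_eq_mul]
  exact Finset.sum_congr rfl fun i _ => by ring

lemma sum_sgn {N : ℕ} (d : Fin N → ℝ) : ∑ i, sgn (d i) =
    (({i | 0 < d i} : Set (Fin N)).ncard : ℤ) - (({i | d i < 0} : Set (Fin N)).ncard : ℤ) := by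
  classical
  have e1 : ({i | 0 < d i} : Set (Fin N)) = ↑(Finset.univ.filter fun i => 0 < d i) := by
    ext; simp
  have e2 : ({i | d i < 0} : Set (Fin N)) = ↑(Finset.univ.filter fun i => d i < 0) := by
    ext; simp
  rw [e1, e2, Set.ncard_coe_finset, Set.ncard_coe_finset, Finset.card_filter, Finset.card_filter]
  push_cast
  rw [← Finset.sum_sub_distrib]
  refine Finset.sum_congr rfl fun i _ => ?_
  unfold sgn
  split_ifs <;> first | rfl | (exfalso; linarith)

lemma msig_eq_sum {N : ℕ} (A : Matrix (Fin N) (Fin N) ℝ) (hA : A.IsHermitian) :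
    msig A hA = ∑ i, sgn (hA.eigenvalues i) := by
  classical
  have e1 : ({i | 0 < hA.eigenvalues i} : Set (Fin N)) =
    ↑(Finset.univ.filter fun i => 0 < hA.eigenvalues i) := by ext; simp
  have e2 : ({i | hA.eigenvalues i < 0} : Set (Fin N)) =
    ↑(Finset.univ.filter fun i => hA.eigenvalues i < 0) := by ext; simp
  rw [sum_sgn, e1, e2, Set.ncard_coe_finset, Set.ncard_coe_finset, msig]

open Matrix in
lemma msig_of_congr {N : ℕ} (A P : Matrix (Fin N) (Fin N) ℝ) (hA : A.IsHermitian)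
    (d : Fin N → ℝ) (hP : P.det ≠ 0) (h : Pᵀ * A * P = Matrix.diagonal d) :
    msig A hA = ∑ i, sgn (d i) := by
  have E := equiv_of_congr A P d hP h
  have F : QuadraticMap.Equivalent A.toQuadraticForm'
      (QuadraticMap.weightedSumSquares ℝ hA.eigenvalues) := by
    refine equiv_of_congr A (hA.eigenvectorUnitary : Matrix (Fin N) (Fin N) ℝ) _ ?_ ?_
    · intro h0
      have h1 := congrArg Matrix.det
        (Unitary.star_mul_self_of_mem (hA.eigenvectorUnitary).2)
      rw [Matrix.det_mul, h0] at h1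
      simp at h1
    · have := hA.conjStarAlgAut_star_eigenvectorUnitary
      rw [Unitary.conjStarAlgAut_star_apply, Matrix.star_eq_conjTranspose, Matrix.conjTranspose_eq_transpose_of_trivial] at this
      exact this
  rw [msig_eq_sum, sum_sgn, sum_sgn,
    ← QuadraticForm.sigPos_of_equiv_weightedSumSquares E,
    ← QuadraticForm.sigNeg_of_equiv_weightedSumSquares E,
    ← QuadraticForm.sigPos_of_equiv_weightedSumSquares F,
    ← QuadraticForm.sigNeg_of_equiv_weightedSumSquares F]

open Matrix in
lemma diag_field {K : Type*} [Field K] [CharZero K] {N : ℕ} (A : Matrix (Fin N) (Fin N) K)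
    (hA : A.IsSymm) : ∃ (P : Matrix (Fin N) (Fin N) K) (d : Fin N → K),
      P.det ≠ 0 ∧ Pᵀ * A * P = Matrix.diagonal d := by
  have : Invertible (2 : K) := invertibleOfNonzero two_ne_zero
  let B : LinearMap.BilinForm K (Fin N → K) := Matrix.toLinearMap₂' K A
  have hB : ∀ x y, B x y = x ⬝ᵥ A *ᵥ y := fun x y => Matrix.toLinearMap₂'_apply' A x y
  have hS : LinearMap.IsSymm B := by
    refine ⟨fun x y => ?_⟩
    rw [RingHom.id_apply, hB, hB, Matrix.dotProduct_mulVec, ← Matrix.mulVec_transpose, hA,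
      dotProduct_comm]
  obtain ⟨v, hv⟩ := LinearMap.BilinForm.exists_orthogonal_basis hS
  have hf : Module.finrank K (Fin N → K) = N := by simp
  let v' := v.reindex (finCongr hf)
  let P : Matrix (Fin N) (Fin N) K := (Pi.basisFun K (Fin N)).toMatrix v'
  have hPe : ∀ i j, P i j = v' j i := fun i j => by simp [P, Module.Basis.toMatrix_apply]
  refine ⟨P, fun i => B (v' i) (v' i), ?_, ?_⟩
  · intro h0
    have h1 := congrArg Matrix.det ((Pi.basisFun K (Fin N)).toMatrix_mul_toMatrix_flip v')
    rw [Matrix.det_mul] at h1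
    change P.det * _ = _ at h1
    rw [h0] at h1
    simp at h1
  · ext i j
    have : (Pᵀ * A * P) i j = B (v' i) (v' j) := by
      rw [hB, Matrix.mul_assoc, Matrix.mul_apply]
      simp only [dotProduct, Matrix.transpose_apply, hPe, Matrix.mul_apply, mulVec]
    rw [this, Matrix.diagonal_apply]
    split_ifs with h
    · rw [h]
    · simp only [v', Module.Basis.reindex_apply]
      exact hv (fun h' => h (by simpa using h'))

open Matrix in
lemma diag_dom {R : Type*} [CommRing R] [IsDomain R] [CharZero R] {N : ℕ}
    (A : Matrix (Fin N) (Fin N) R)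
    (hA : A.IsSymm) : ∃ (P : Matrix (Fin N) (Fin N) R) (d : Fin N → R),
      P.det ≠ 0 ∧ Pᵀ * A * P = Matrix.diagonal d := by
  let K := FractionRing R
  let f : R →+* K := algebraMap R K
  have hf : Function.Injective f := IsFractionRing.injective R K
  have : CharZero K := charZero_of_injective_algebraMap hf
  obtain ⟨P, d, hP, h⟩ := diag_field (A.map f) (hA.map f)
  obtain ⟨b, hb⟩ := IsLocalization.exist_integer_multiples_of_finite (nonZeroDivisors R)
    (fun ij : Fin N × Fin N => P ij.1 ij.2)
  choose g hg using hb
  let P' : Matrix (Fin N) (Fin N) R := fun i j => g (i, j)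
  have hb0 : f b ≠ 0 := by
    rw [Ne, map_eq_zero_iff f hf]; exact nonZeroDivisors.coe_ne_zero b
  have hP' : P'.map f = f b • P := by
    ext i j
    have := hg (i, j)
    rw [Algebra.smul_def] at this
    exact this
  have hD : (P'ᵀ * A * P').map f = (f b * f b) • Matrix.diagonal d := by
    rw [Matrix.map_mul, Matrix.map_mul, Matrix.transpose_map, hP', ← h]
    simp [smul_smul]
  refine ⟨P', fun i => (P'ᵀ * A * P') i i, ?_, ?_⟩
  · intro h0
    have h1 : (P'.map f).det = 0 := by
      have := RingHom.map_det f P'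
      rw [h0, map_zero] at this
      exact this.symm
    rw [hP', Matrix.det_smul] at h1
    rcases mul_eq_zero.mp h1 with h2 | h2
    · exact pow_ne_zero _ hb0 h2
    · exact hP h2
  · ext i j
    rw [Matrix.diagonal_apply]
    split_ifs with hij
    · rw [hij]
    · apply hf
      have := congrFun (congrFun hD i) j
      rw [Matrix.map_apply] at this
      rw [this]
      simp [Matrix.diagonal_apply, hij]

/-- The signature of a symmetric matrix with polynomial entries, nondegenerate on `U`,
is a finite sum of signs of polynomials off a proper algebraic subset. -/
theorem stmt12 {m N : ℕ} (W U : Set (Fin m → ℝ)) (hUW : U ⊆ W)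
    (p : Matrix (Fin N) (Fin N) (MvPolynomial (Fin m) ℝ))
    (hsym : ∀ w : Fin m → ℝ, (p.map (MvPolynomial.eval w)).IsHermitian)
    (hdet : ∀ w ∈ U, (p.map (MvPolynomial.eval w)).det ≠ 0) :
    ∃ (t : ℕ) (q : Fin t → MvPolynomial (Fin m) ℝ) (σ : MvPolynomial (Fin m) ℝ),
      σ ≠ 0 ∧ ∀ w ∈ U, MvPolynomial.eval w σ ≠ 0 →
        (∀ i, MvPolynomial.eval w (q i) ≠ 0) ∧
        msig (p.map (MvPolynomial.eval w)) (hsym w) =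
          ∑ i, sgn (MvPolynomial.eval w (q i)) := by
  classical
  rcases U.eq_empty_or_nonempty with rfl | ⟨w0, hw0⟩
  · exact ⟨0, fun _ => 1, 1, one_ne_zero, fun w hw => absurd hw (Set.notMem_empty w)⟩
  have hp : p.IsSymm := by
    ext i j : 1
    apply MvPolynomial.funext
    intro w
    have := congrFun (congrFun (hsym w) i) j
    simpa [Matrix.conjTranspose_apply] using this
  have hev : ∀ (w : Fin m → ℝ) (M : Matrix (Fin N) (Fin N) (MvPolynomial (Fin m) ℝ)),
      (M.map (MvPolynomial.eval w)).det = MvPolynomial.eval w M.det := fun w M =>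
    (RingHom.map_det (MvPolynomial.eval w) M).symm
  have hp0 : p.det ≠ 0 := by
    intro h0
    apply hdet w0 hw0
    rw [hev, h0, map_zero]
  obtain ⟨P, d, hP, h⟩ := diag_dom p hp
  have hprod : P.det * p.det * P.det = ∏ i, d i := by
    rw [← Matrix.det_diagonal, ← h, Matrix.det_mul, Matrix.det_mul, Matrix.det_transpose]
  refine ⟨N, d, ∏ i, d i, ?_, fun w _ hσ => ⟨?_, ?_⟩⟩
  · rw [← hprod]
    exact mul_ne_zero (mul_ne_zero hP hp0) hP
  · intro i h0
    apply hσ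
    rw [map_prod]
    exact Finset.prod_eq_zero (Finset.mem_univ i) h0
  · apply msig_of_congr _ (P.map (MvPolynomial.eval w))
    · rw [hev]
      intro h0
      apply hσ
      rw [← hprod, map_mul, h0, mul_zero]
    · rw [← Matrix.transpose_map, ← Matrix.map_mul, ← Matrix.map_mul, h,
        Matrix.diagonal_map (map_zero _)]
end

section
/- Let f : ℝ^n × ℝ → ℝ be a nonnegative homogeneous polynomial of degree 2d with f(x,0) = ‖x‖^{2d}, and let g(x,t) = f(x,t) − t^{2d+1}. For η < 0 the set {x : g(x,η) ≤ 0} is empty, and for η = 0 it equals {0}. Moreover, since f is nonnegative, homogeneous of degree 2d, and its critical set Σ = {∂f/∂x_1 = ... = ∂f/∂x_n = 0} is a homogeneous (cone) set, there is D > 0 such that every nonzero critical value y of f restricted to the slice ℝ^n × {η} satisfies y > D|η|^{2d}. -/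
open scoped TensorProduct in
lemma aux_D_ne_zero {K : Type} [Field K] [Algebra ℝ K] (h : K) (ht : Transcendental ℝ h) :
    KaehlerDifferential.D ℝ K h ≠ 0 := by
  have hinj : Function.Injective (Polynomial.aeval (R := ℝ) h) :=
    transcendental_iff_injective.mp ht
  let : Algebra (Polynomial ℝ) K := (Polynomial.aeval (R := ℝ) h).toRingHom.toAlgebra
  have hmap : ∀ p : Polynomial ℝ, algebraMap (Polynomial ℝ) K p = Polynomial.aeval h p :=
    fun p => rfl
  have : IsScalarTower ℝ (Polynomial ℝ) K := IsScalarTower.of_algebraMap_eq fun r => by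
    rw [hmap]; simp
  have : FaithfulSMul (Polynomial ℝ) K := (faithfulSMul_iff_algebraMap_injective _ _).mpr hinj
  let F := FractionRing (Polynomial ℝ)
  let : Algebra F K := FractionRing.liftAlgebra (Polynomial ℝ) K
  have : IsScalarTower (Polynomial ℝ) F K := FractionRing.isScalarTower_liftAlgebra _ K
  have : CharZero F := by
    have : FaithfulSMul ℝ F := inferInstance
    exact algebraRat.charZero F
  have hFK : Algebra.FormallySmooth F K := by
    obtain ⟨s, hs⟩ := exists_isTranscendenceBasis F K
    have := hs.isAlgebraic_field
    exact Algebra.FormallySmooth.of_algebraicIndependent_of_isSeparable hs.1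
  have : Algebra.FormallySmooth (Polynomial ℝ) F :=
    .of_isLocalization (nonZeroDivisors _)
  have : Algebra.FormallySmooth (Polynomial ℝ) K := .comp _ F _
  have : Subsingleton (Algebra.H1Cotangent (Polynomial ℝ) K) :=
    Algebra.FormallySmooth.subsingleton_h1Cotangent
  intro h0
  have hx : KaehlerDifferential.mapBaseChange ℝ (Polynomial ℝ) K
      (1 ⊗ₜ KaehlerDifferential.D ℝ (Polynomial ℝ) Polynomial.X) = 0 := by
    simp [hmap, h0]
  obtain ⟨z, hz⟩ := (Algebra.H1Cotangent.exact_δ_mapBaseChange ℝ (Polynomial ℝ) K _).mp hx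
  rw [Subsingleton.elim z 0, map_zero] at hz
  let e : K ⊗[Polynomial ℝ] (Ω[Polynomial ℝ⁄ℝ]) ≃ₗ[Polynomial ℝ] K :=
    (TensorProduct.congr (LinearEquiv.refl _ K)
      (KaehlerDifferential.polynomialEquiv ℝ)).trans (TensorProduct.rid _ K)
  have := congrArg e hz
  simp [e] at this

lemma aux_D_zero {σ K : Type} [Field K] [Algebra ℝ K] (Q : MvPolynomial σ ℝ)
    (φ : MvPolynomial σ ℝ →ₐ[ℝ] K) (hp : ∀ i, φ (MvPolynomial.pderiv i Q) = 0) :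
    KaehlerDifferential.D ℝ K (φ Q) = 0 := by
  let _ : Algebra (MvPolynomial σ ℝ) K := φ.toRingHom.toAlgebra
  have : IsScalarTower ℝ (MvPolynomial σ ℝ) K := IsScalarTower.of_algebraMap_eq fun r =>
    (φ.commutes r).symm
  have h1 : KaehlerDifferential.D ℝ K (φ Q) =
      KaehlerDifferential.map ℝ ℝ (MvPolynomial σ ℝ) K (KaehlerDifferential.D ℝ _ Q) := by
    rw [KaehlerDifferential.map_D]; rfl
  have h2 := (KaehlerDifferential.mvPolynomialBasis ℝ σ).linearCombination_repr
    (KaehlerDifferential.D ℝ _ Q)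
  rw [h1, ← h2, Finsupp.linearCombination_apply, Finsupp.sum, map_sum]
  refine Finset.sum_eq_zero fun i _ => ?_
  rw [map_smul, KaehlerDifferential.mvPolynomialBasis_repr_apply, algebra_compatible_smul K]
  have : algebraMap (MvPolynomial σ ℝ) K (MvPolynomial.pderiv i Q) = 0 := hp i
  rw [this, zero_smul]

lemma aux_alg {σ : Type} (Q : MvPolynomial σ ℝ) (p : Ideal (MvPolynomial σ ℝ)) [p.IsPrime]
    (hp : ∀ i, MvPolynomial.pderiv i Q ∈ p) :
    ∃ q : Polynomial ℝ, q ≠ 0 ∧ Polynomial.aeval Q q ∈ p := by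
  let A := MvPolynomial σ ℝ ⧸ p
  let K := FractionRing A
  let φ : MvPolynomial σ ℝ →ₐ[ℝ] K := (IsScalarTower.toAlgHom ℝ A K).comp (Ideal.Quotient.mkₐ ℝ p)
  have hφ : ∀ a, φ a = 0 ↔ a ∈ p := by
    intro a
    have : φ a = algebraMap A K (Ideal.Quotient.mk p a) := rfl
    rw [this, FaithfulSMul.algebraMap_eq_zero_iff, Ideal.Quotient.eq_zero_iff_mem]
  have hD : KaehlerDifferential.D ℝ K (φ Q) = 0 :=
    aux_D_zero Q φ fun i => (hφ _).mpr (hp i)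
  have hnt : IsAlgebraic ℝ (φ Q) := by
    by_contra hc
    exact aux_D_ne_zero (φ Q) hc hD
  obtain ⟨q, hq0, hq⟩ := hnt
  refine ⟨q, hq0, ?_⟩
  rw [← hφ, ← hq, Polynomial.aeval_algHom_apply]

lemma aux_fin {n : ℕ} (Q : MvPolynomial (Fin n) ℝ) :
    ∃ q : Polynomial ℝ, q ≠ 0 ∧ ∀ x : Fin n → ℝ,
      (∀ i, MvPolynomial.eval x (MvPolynomial.pderiv i Q) = 0) →
        q.eval (MvPolynomial.eval x Q) = 0 := by
  let I : Ideal (MvPolynomial (Fin n) ℝ) := Ideal.span (Set.range fun i => MvPolynomial.pderiv i Q)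
  have hfin := Ideal.finite_minimalPrimes_of_isNoetherianRing _ I
  have H : ∀ p ∈ I.minimalPrimes, ∃ q : Polynomial ℝ, q ≠ 0 ∧ Polynomial.aeval Q q ∈ p := by
    intro p hp
    have := hp.1.1
    exact aux_alg Q p fun i => hp.1.2 (Ideal.subset_span ⟨i, rfl⟩)
  choose! q hq0 hq using H
  refine ⟨∏ p ∈ hfin.toFinset, q p, ?_, fun x hx => ?_⟩
  · exact Finset.prod_ne_zero_iff.mpr fun p hp => hq0 p (hfin.mem_toFinset.mp hp)
  · let J := RingHom.ker (MvPolynomial.eval x)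
    have : J.IsPrime := RingHom.ker_isPrime _
    have hIJ : I ≤ J := Ideal.span_le.mpr (by rintro _ ⟨i, rfl⟩; exact hx i)
    obtain ⟨p, hp, hpJ⟩ := Ideal.exists_minimalPrimes_le hIJ
    have h1 : MvPolynomial.eval x (Polynomial.aeval Q (q p)) = 0 := hpJ (hq p hp)
    rw [Polynomial.eval_prod]
    refine Finset.prod_eq_zero (hfin.mem_toFinset.mpr hp) ?_
    rw [← h1]
    have := Polynomial.aeval_algHom_apply (MvPolynomial.aeval x : MvPolynomial (Fin n) ℝ →ₐ[ℝ] ℝ) Q (q p)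
    simpa [MvPolynomial.aeval_eq_eval, Polynomial.aeval_def] using this

lemma aux_fderiv {n : ℕ} (Q : MvPolynomial (Fin n) ℝ) (x : Fin n → ℝ) :
    HasFDerivAt (fun y => MvPolynomial.eval y Q)
      (∑ i, MvPolynomial.eval x (MvPolynomial.pderiv i Q) •
        (ContinuousLinearMap.proj i : (Fin n → ℝ) →L[ℝ] ℝ)) x := by
  induction Q using MvPolynomial.induction_on with
  | C a => simpa using hasFDerivAt_const a x
  | add p q hp hq =>
    simp only [map_add, add_smul, Finset.sum_add_distrib]
    exact hp.add hq
  | mul_X p i hp =>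
    have h := hp.mul (hasFDerivAt_apply (𝕜 := ℝ) i x)
    simp only [map_mul, MvPolynomial.eval_X]
    refine h.congr_fderiv ?_
    ext v
    simp [Derivation.leibniz, MvPolynomial.pderiv_X, Pi.single_apply, add_mul,
      Finset.sum_add_distrib, Finset.mul_sum, apply_ite, mul_assoc]

lemma aux_bound {n : ℕ} (Q : MvPolynomial (Fin n) ℝ) :
    ∃ D > 0, ∀ x : Fin n → ℝ, fderiv ℝ (fun y => MvPolynomial.eval y Q) x = 0 →
      0 < MvPolynomial.eval x Q → D < MvPolynomial.eval x Q := by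
  obtain ⟨q, hq0, hq⟩ := aux_fin Q
  have hev : ∀ᶠ D in nhdsWithin (0:ℝ) (Set.Ioi 0), ∀ y ∈ q.roots.toFinset, 0 < y → D < y := by
    rw [Filter.eventually_all_finset]
    intro y _
    by_cases hy : 0 < y
    · filter_upwards [Ioo_mem_nhdsGT hy] with D hD _ using hD.2
    · exact Filter.Eventually.of_forall fun D h => absurd h hy
  obtain ⟨D, hD, hD0⟩ := (hev.and self_mem_nhdsWithin).exists
  refine ⟨D, hD0, fun x hx hpos => hD _ ?_ hpos⟩
  rw [Multiset.mem_toFinset, Polynomial.mem_roots hq0]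
  refine hq x fun i => ?_
  have h := (aux_fderiv Q x).fderiv
  rw [hx] at h
  have := congrArg (fun L : (Fin n → ℝ) →L[ℝ] ℝ => L (Pi.single i 1)) h
  simpa [Pi.single_apply] using this.symm

theorem stmt19 {n d : ℕ} (hd : 0 < d)
    (f : (Fin n → ℝ) → ℝ → ℝ)
    (P : MvPolynomial (Fin n ⊕ Unit) ℝ)
    (hfP : ∀ x t, f x t = MvPolynomial.eval (Sum.elim x fun _ => t) P)
    (hpos : ∀ x t, 0 ≤ f x t)
    (hhom : ∀ lam : ℝ, 0 < lam → ∀ x t, f (lam • x) (lam * t) = lam ^ (2 * d) * f x t)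
    (hf0 : ∀ x, f x 0 = (∑ i, x i ^ 2) ^ d)
    (g : (Fin n → ℝ) → ℝ → ℝ) (hg : ∀ x t, g x t = f x t - t ^ (2 * d + 1)) :
    (∀ η : ℝ, η < 0 → {x : Fin n → ℝ | g x η ≤ 0} = ∅) ∧
    ({x : Fin n → ℝ | g x 0 ≤ 0} = {0}) ∧
    (∃ D > 0, ∀ (η : ℝ) (x : Fin n → ℝ),
      fderiv ℝ (fun y => f y η) x = 0 → f x η ≠ 0 → f x η > D * |η| ^ (2 * d)) := by
  refine ⟨fun η hη => ?_, ?_, ?_⟩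
  · ext x
    simp only [Set.mem_ofPred_eq, Set.mem_empty_iff_false, iff_false, not_le, hg]
    have h1 : η ^ (2 * d + 1) < 0 := (Odd.pow_neg_iff ⟨d, rfl⟩).mpr hη
    linarith [hpos x η]
  · ext x
    have hS : 0 ≤ ∑ i, x i ^ 2 := Finset.sum_nonneg fun i _ => sq_nonneg _
    simp only [Set.mem_ofPred_eq, Set.mem_singleton_iff, hg, hf0]
    rw [zero_pow (by omega), sub_zero]
    constructor
    · intro h
      have h0 : (∑ i, x i ^ 2) ^ d = 0 := le_antisymm h (pow_nonneg hS d)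
      have h1 := pow_eq_zero_iff hd.ne' |>.mp h0
      rw [Finset.sum_eq_zero_iff_of_nonneg fun i _ => sq_nonneg _] at h1
      funext i
      simpa using h1 i (Finset.mem_univ i)
    · rintro rfl
      simp [hd.ne']
  · have key : ∀ s : ℝ, ∃ D > 0, ∀ x : Fin n → ℝ, fderiv ℝ (fun y => f y s) x = 0 →
        0 < f x s → D < f x s := by
      intro s
      obtain ⟨D, hD, H⟩ := aux_bound (MvPolynomial.aeval
        (Sum.elim MvPolynomial.X fun _ => MvPolynomial.C s :
          Fin n ⊕ Unit → MvPolynomial (Fin n) ℝ) P)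
      have he : ∀ y, MvPolynomial.eval y (MvPolynomial.aeval
        (Sum.elim MvPolynomial.X fun _ => MvPolynomial.C s :
          Fin n ⊕ Unit → MvPolynomial (Fin n) ℝ) P) = f y s := by
        intro y
        rw [hfP, MvPolynomial.aeval_def, MvPolynomial.eval₂_eq_eval_map]
        rw [← MvPolynomial.eval₂_eq_eval_map, MvPolynomial.hom_eval₂]
        have : (MvPolynomial.eval y).comp (algebraMap ℝ (MvPolynomial (Fin n) ℝ)) =
          RingHom.id ℝ := by ext; simp
        rw [this]
        change MvPolynomial.eval _ P = _
        congr 2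
        funext i
        cases i <;> simp
      simp only [he] at H
      exact ⟨D, hD, H⟩
    obtain ⟨D1, hD1, H1⟩ := key 1
    obtain ⟨D2, hD2, H2⟩ := key (-1)
    refine ⟨min D1 D2, lt_min hD1 hD2, fun η x hx hne => ?_⟩
    have hp : 0 < f x η := lt_of_le_of_ne (hpos x η) hne.symm
    rcases eq_or_ne η 0 with rfl | hη
    · simpa [hd.ne'] using hp
    have ha : 0 < |η| := abs_pos.mpr hη
    have hs : ∀ y, f y (|η|⁻¹ * η) = |η|⁻¹ ^ (2 * d) * f (|η| • y) η := by
      intro y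
      rw [← hhom _ (inv_pos.mpr ha), smul_smul, inv_mul_cancel₀ ha.ne', one_smul]
    have hxx : |η| • |η|⁻¹ • x = x := by rw [smul_smul, mul_inv_cancel₀ ha.ne', one_smul]
    have hval : f (|η|⁻¹ • x) (|η|⁻¹ * η) = |η|⁻¹ ^ (2 * d) * f x η := hhom _ (inv_pos.mpr ha) _ _
    have hder : fderiv ℝ (fun y => f y (|η|⁻¹ * η)) (|η|⁻¹ • x) = 0 := by
      simp only [hs]
      have hsm := fderiv_comp_smul (𝕜 := ℝ) (f := fun y => f y η) (x := |η|⁻¹ • x) |η|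
      rw [hxx, hx, smul_zero] at hsm
      have h4 : (fun y => |η|⁻¹ ^ (2 * d) * f (|η| • y) η) =
        (|η|⁻¹ ^ (2 * d)) • (fun y => f (|η| • y) η) := rfl
      rw [h4, fderiv_const_smul_field, Pi.smul_apply, hsm, smul_zero]
    have hvp : 0 < f (|η|⁻¹ • x) (|η|⁻¹ * η) := by rw [hval]; positivity
    have hlt : min D1 D2 < f (|η|⁻¹ • x) (|η|⁻¹ * η) := by
      rcases lt_or_gt_of_ne hη with h | h
      · have e : |η|⁻¹ * η = -1 := by rw [abs_of_neg h]; field_simp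
        rw [e] at hder hvp ⊢
        exact (min_le_right _ _).trans_lt (H2 _ hder hvp)
      · have e : |η|⁻¹ * η = 1 := by rw [abs_of_pos h]; field_simp
        rw [e] at hder hvp ⊢
        exact (min_le_left _ _).trans_lt (H1 _ hder hvp)
    rw [hval, inv_pow, inv_mul_eq_div, lt_div_iff₀ (pow_pos ha _)] at hlt
    exact hlt
end
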